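/- Let n, m be natural numbers, q = max(n,m), and let X₁, X₂ be independent random variables each uniformly distributed on (ZMod 2)^q. Let D : (ZMod 2)^q → (ZMod 2)^q be the down-shift map ((Dx)_1 = 0 and (Dx)_j = x_{j−1} for j ≥ 2). Define V₁ = D^{q−m} X₁, V₂ = D^{q−m} X₂, Y₁ = D^{q−n} X₁ + V₂ and Y₂ = D^{q−n} X₂ + V₁ (addition componentwise in ZMod 2). Then H[Y₁ | (V₁, V₂)] + H[Y₂] = (max(n,m) + max(n−m, 0)) · log 2, where H denotes Shannon entropy (natural logarithm) and H[·|·] conditional Shannon entropy. -/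

import Mathlib

open MeasureTheory

/-- Shannon entropy (in nats) of a random variable `X` with values in a
finite type, with respect to the measure `μ`. -/
noncomputable def shannonEntropy {Ω S : Type*} [MeasurableSpace Ω] [Fintype S]
    (μ : Measure Ω) (X : Ω → S) : ℝ :=
  ∑ s : S, Real.negMulLog (μ (X ⁻¹' {s})).toReal

/-- Conditional Shannon entropy `H[X | Z] = H[(X,Z)] − H[Z]` (in nats). -/
noncomputable def condShannonEntropy {Ω S T : Type*} [MeasurableSpace Ω]
    [Fintype S] [Fintype T] (μ : Measure Ω) (X : Ω → S) (Z : Ω → T) : ℝ :=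
  shannonEntropy μ (fun ω => (X ω, Z ω)) - shannonEntropy μ Z

/-- The down-shift map on `q` bit levels: `(D x)₀ = 0` and `(D x)ⱼ = x_{j−1}`. -/
def downShift (q : ℕ) (x : Fin q → ZMod 2) : Fin q → ZMod 2 :=
  fun j => if h : (j : ℕ) = 0 then 0 else x ⟨(j : ℕ) - 1, by omega⟩

/-- If `X` is uniform on a finite group `G`, `h` is a surjective homomorphism onto `T`, and `f` has
the same fibres as `h`, then the entropy of `f ∘ X` is `log |T|`. -/
theorem shannonEntropy_comp_of_uniform {Ω G S T : Type*} [MeasurableSpace Ω] {μ : Measure Ω}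
    [Fintype G] [AddGroup G] [MeasurableSpace G] [MeasurableSingletonClass G]
    [Fintype S] [Fintype T] [AddGroup T] {X : Ω → G} (hX : Measurable X)
    (hunif : ∀ g, μ (X ⁻¹' {g}) = (Fintype.card G : ENNReal)⁻¹)
    (f : G → S) (h : G →+ T) (hh : Function.Surjective h)
    (hf : ∀ x y, f x = f y ↔ h x = h y) :
    shannonEntropy μ (fun ω => f (X ω)) = Real.log (Fintype.card T) := by
  classical
  set c : ℕ := (Finset.univ.filter fun g => h g = 0).card with hc
  have hfib : ∀ t, (Finset.univ.filter fun g => h g = t).card = c := fun t =>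
    AddMonoidHom.card_fiber_eq_of_mem_range h (hh t) (hh 0)
  have hcard : Fintype.card G = Fintype.card T * c := by
    have := Finset.card_eq_sum_card_fiberwise (f := h) (s := Finset.univ) (t := Finset.univ)
      (by simp)
    simpa [hfib] using this
  have hG : (Fintype.card G : ℝ) ≠ 0 := by exact_mod_cast Fintype.card_ne_zero
  have hT : (Fintype.card T : ℝ) ≠ 0 := by exact_mod_cast Fintype.card_ne_zero
  have hc0 : (c : ℝ) ≠ 0 := by
    intro h0
    apply hG
    rw [hcard]
    push_cast
    rw [h0, mul_zero]
  have hmeas : ∀ s, (μ ((fun ω => f (X ω)) ⁻¹' {s})).toReal =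
      ((Finset.univ.filter fun g => f g = s).card : ℝ) * (Fintype.card G : ℝ)⁻¹ := by
    intro s
    have h1 := sum_measure_preimage_singleton (μ := μ) (f := X)
      (Finset.univ.filter fun g => f g = s)
      (fun y _ => hX (measurableSet_singleton y))
    have h2 : X ⁻¹' ((Finset.univ.filter fun g => f g = s : Finset G) : Set G) =
        (fun ω => f (X ω)) ⁻¹' {s} := by
      ext ω
      simp
    rw [← h2, ← h1]
    simp [hunif]
  have hinj : Function.Injective fun t => f (Function.surjInv hh t) := by
    intro a b hab
    have := (hf _ _).1 hab
    rwa [Function.surjInv_eq hh, Function.surjInv_eq hh] at this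
  have hval : ∀ t, (μ ((fun ω => f (X ω)) ⁻¹' {f (Function.surjInv hh t)})).toReal =
      (Fintype.card T : ℝ)⁻¹ := by
    intro t
    rw [hmeas]
    simp only [hf, Function.surjInv_eq hh, hfib]
    rw [hcard]
    push_cast
    field_simp
  unfold shannonEntropy
  rw [← Finset.sum_subset (Finset.subset_univ
    (Finset.univ.image fun t => f (Function.surjInv hh t)))]
  · rw [Finset.sum_image hinj.injOn]
    simp only [hval, Finset.sum_const, Finset.card_univ, nsmul_eq_mul, Real.negMulLog,
      Real.log_inv]
    field_simp
  · intro s _ hs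
    rw [hmeas, Finset.filter_false_of_mem]
    · simp
    · rintro g - rfl
      refine hs (Finset.mem_image.2 ⟨h g, Finset.mem_univ _, ?_⟩)
      rw [hf, Function.surjInv_eq hh]

theorem downShift_iterate_apply (q k : ℕ) (x : Fin q → ZMod 2) (j : Fin q) :
    (downShift q)^[k] x j =
      if (j : ℕ) < k then 0 else x ⟨(j : ℕ) - k, (Nat.sub_le _ _).trans_lt j.2⟩ := by
  induction k generalizing j with
  | zero => simp
  | succ k ih =>
    rw [Function.iterate_succ_apply', downShift]
    split_ifs with h1 h2 h2
    · rfl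
    · omega
    · rw [ih, if_pos (by simp only; omega)]
    · rw [ih, if_neg (by simp only; omega)]
      congr 2
      simp only
      omega

theorem downShift_iterate_add (q k : ℕ) (x y : Fin q → ZMod 2) :
    (downShift q)^[k] (x + y) = (downShift q)^[k] x + (downShift q)^[k] y := by
  ext j
  simp only [Pi.add_apply, downShift_iterate_apply]
  split_ifs <;> simp

theorem downShift_iterate_zero (q k : ℕ) : (downShift q)^[k] 0 = 0 := by
  ext j
  simp [downShift_iterate_apply]

/-- Shifting down by `q - m` levels retains exactly the top `m` levels. -/
theorem downShift_iterate_sub_eq_iff {q m : ℕ} (hm : m ≤ q) (x y : Fin q → ZMod 2) :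
    (downShift q)^[q - m] x = (downShift q)^[q - m] y ↔
      LinearMap.funLeft (ZMod 2) (ZMod 2) (Fin.castLE hm) x =
        LinearMap.funLeft (ZMod 2) (ZMod 2) (Fin.castLE hm) y := by
  simp only [funext_iff, LinearMap.funLeft_apply, downShift_iterate_apply]
  constructor
  · intro h i
    have := h ⟨i + (q - m), by omega⟩
    simpa [Fin.castLE] using this
  · intro h j
    split_ifs with hj
    · rfl
    · simpa [Fin.castLE] using h ⟨j - (q - m), by omega⟩

/-- Independent uniform inputs attain the maximum in the converse of
Theorem 1: `H[Y₁ | (V₁,V₂)] + H[Y₂] = (max(n,m) + (n−m)⁺) · log 2`. -/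
theorem det_converse_entropy_eq (n m : ℕ) {Ω : Type*} [MeasurableSpace Ω]
    (μ : Measure Ω) [IsProbabilityMeasure μ]
    (X₁ X₂ : Ω → (Fin (max n m) → ZMod 2))
    (hX₁ : Measurable X₁) (hX₂ : Measurable X₂)
    (hindep : ProbabilityTheory.IndepFun X₁ X₂ μ)
    (hunif₁ : ∀ s : Fin (max n m) → ZMod 2,
      μ (X₁ ⁻¹' {s}) = ((Fintype.card (Fin (max n m) → ZMod 2) : ENNReal))⁻¹)
    (hunif₂ : ∀ s : Fin (max n m) → ZMod 2,
      μ (X₂ ⁻¹' {s}) = ((Fintype.card (Fin (max n m) → ZMod 2) : ENNReal))⁻¹)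
    (V₁ V₂ Y₁ Y₂ : Ω → (Fin (max n m) → ZMod 2))
    (hV₁ : V₁ = fun ω => (downShift (max n m))^[max n m - m] (X₁ ω))
    (hV₂ : V₂ = fun ω => (downShift (max n m))^[max n m - m] (X₂ ω))
    (hY₁ : Y₁ = fun ω => (downShift (max n m))^[max n m - n] (X₁ ω) + V₂ ω)
    (hY₂ : Y₂ = fun ω => (downShift (max n m))^[max n m - n] (X₂ ω) + V₁ ω) :
    condShannonEntropy μ Y₁ (fun ω => (V₁ ω, V₂ ω)) + shannonEntropy μ Y₂ =
      ((max n m + (n - m) : ℕ) : ℝ) * Real.log 2 := by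
  have hm : m ≤ max n m := le_max_right n m
  have hcase : max n m - n = 0 ∨ max n m - m = 0 := by omega
  have hcount : (max n m + (n - m)) + 2 * m = max n m + m + max n m := by omega
  generalize max n m = q at *
  let D (k : ℕ) : (Fin q → ZMod 2) → (Fin q → ZMod 2) := (downShift q)^[k]
  let R : (Fin q → ZMod 2) →+ (Fin m → ZMod 2) :=
    (LinearMap.funLeft (ZMod 2) (ZMod 2) (Fin.castLE hm)).toAddMonoidHom
  have hR : Function.Surjective R :=
    LinearMap.funLeft_surjective_of_injective (ZMod 2) (ZMod 2) _ (Fin.castLE_injective hm)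
  have hDR : ∀ x y, D (q - m) x = D (q - m) y ↔ R x = R y := downShift_iterate_sub_eq_iff hm
  have hX : Measurable fun ω => (X₁ ω, X₂ ω) := hX₁.prodMk hX₂
  have hunif : ∀ g : (Fin q → ZMod 2) × (Fin q → ZMod 2), μ ((fun ω => (X₁ ω, X₂ ω)) ⁻¹' {g}) =
      (Fintype.card ((Fin q → ZMod 2) × (Fin q → ZMod 2)) : ENNReal)⁻¹ := by
    rintro ⟨a, b⟩
    have h1 := hindep.measure_inter_preimage_eq_mul _ _
      (measurableSet_singleton a) (measurableSet_singleton b)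
    rw [hunif₁, hunif₂] at h1
    have h2 : (fun ω => (X₁ ω, X₂ ω)) ⁻¹' {(a, b)} = X₁ ⁻¹' {a} ∩ X₂ ⁻¹' {b} := by
      ext ω
      simp
    rw [h2, h1, Fintype.card_prod, Nat.cast_mul, ENNReal.mul_inv (by simp) (by simp)]
  have hV : shannonEntropy μ (fun ω => (V₁ ω, V₂ ω)) = (2 * m : ℕ) * Real.log 2 := by
    have := shannonEntropy_comp_of_uniform hX hunif
      (fun p => (D (q - m) p.1, D (q - m) p.2)) (R.prodMap R) (hR.prodMap hR)
      (by simp [hDR])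
    rw [hV₁, hV₂]
    refine this.trans ?_
    rw [← Real.log_pow]
    simp [← pow_add, two_mul]
  have hYV : shannonEntropy μ (fun ω => (Y₁ ω, (V₁ ω, V₂ ω))) =
      (q + m : ℕ) * Real.log 2 := by
    have := shannonEntropy_comp_of_uniform hX hunif
      (fun p => (D (q - n) p.1 + D (q - m) p.2, (D (q - m) p.1, D (q - m) p.2)))
      ((AddMonoidHom.id (Fin q → ZMod 2)).prodMap R) (Function.surjective_id.prodMap hR) (by
        rintro ⟨x₁, x₂⟩ ⟨y₁, y₂⟩
        simp only [Prod.mk.injEq, AddMonoidHom.prodMap_def, AddMonoidHom.prod_apply,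
          AddMonoidHom.comp_apply, AddMonoidHom.id_apply, AddMonoidHom.coe_fst,
          AddMonoidHom.coe_snd, ← hDR]
        constructor
        · rintro ⟨h1, h2, h3⟩
          refine ⟨?_, h3⟩
          rw [h3, add_left_inj] at h1
          rcases hcase with h0 | h0
          · simpa [D, h0] using h1
          · simpa [D, h0] using h2
        · rintro ⟨rfl, h3⟩
          simp [h3])
    rw [hY₁, hV₁, hV₂]
    refine this.trans ?_
    rw [← Real.log_pow]
    simp [← pow_add]
  have hY : shannonEntropy μ Y₂ = q * Real.log 2 := by
    let h : (Fin q → ZMod 2) × (Fin q → ZMod 2) →+ (Fin q → ZMod 2) :=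
      AddMonoidHom.mk' (fun p => D (q - n) p.2 + D (q - m) p.1) (by
        intro p₁ p₂
        simp only [D, Prod.fst_add, Prod.snd_add, downShift_iterate_add]
        abel)
    have hh : Function.Surjective h := by
      intro y
      rcases hcase with h0 | h0
      · exact ⟨(0, y), by simp [h, D, h0, downShift_iterate_zero]⟩
      · exact ⟨(y, 0), by simp [h, D, h0, downShift_iterate_zero]⟩
    have := shannonEntropy_comp_of_uniform hX hunif h h hh (fun _ _ => Iff.rfl)
    rw [hY₂, hV₁]
    refine this.trans ?_
    rw [← Real.log_pow]
    simp
  have hcount' : ((q + (n - m) : ℕ) : ℝ) + (2 * m : ℕ) = (q + m : ℕ) + q := by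
    exact_mod_cast hcount
  rw [condShannonEntropy, hYV, hV, hY]
  linear_combination -Real.log 2 * hcount'
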